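/- Suppose [y,x] = 1 for elements x, y of the first Weyl algebra A₁ over a field K of characteristic zero; let A₁' := K⟨x,y⟩, δ_x := ad(x), δ_y := ad(y), and h := yx. Then the following are equivalent: (a) D(h) = A₁'; (b) δ_x is a locally nilpotent derivation of the algebra D(h); (c) δ_y is a locally nilpotent derivation of the algebra D(h); (d) the composite map δ_xδ_y is a locally nilpotent linear map of D(h). -/

import Mathlib

def weylRel (K : Type*) [CommRing K] :
    FreeAlgebra K (Fin 2) → FreeAlgebra K (Fin 2) → Prop :=
  fun a b => a = FreeAlgebra.ι K 1 * FreeAlgebra.ι K 0 ∧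
    b = FreeAlgebra.ι K 0 * FreeAlgebra.ι K 1 + 1

/-- The first Weyl algebra `A₁ = K⟨X, Y | YX - XY = 1⟩` over `K`,
realized as the quotient of the free algebra on two generators `X, Y`
by the relation `Y * X = X * Y + 1`. -/
abbrev WeylAlgebra (K : Type*) [CommRing K] := RingQuot (weylRel K)

/-- The eigenvector algebra `D(h)` of an element `h` of the Weyl algebra: the subalgebra
generated by all eigenvectors of the inner derivation `ad(h) = [h, ·]`. -/
noncomputable def eigenvectorAlgebra (K : Type*) [Field K] (h : WeylAlgebra K) :
    Subalgebra K (WeylAlgebra K) :=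
  Algebra.adjoin K {b : WeylAlgebra K | ∃ lam : K, b ≠ 0 ∧ h * b - b * h = lam • b}

namespace WeylAux
open MvPolynomial

abbrev PP (K : Type*) [CommRing K] := MvPolynomial (Fin 2) K

/-- polynomials of total degree `< n` -/
def Q (K : Type*) [CommRing K] (n : ℕ) : Submodule K (PP K) where
  carrier := {p | ∀ d : Fin 2 →₀ ℕ, n ≤ d 0 + d 1 → coeff d p = 0}
  add_mem' := by
    intro a b ha hb d hd
    simp [ha d hd, hb d hd]
  zero_mem' := by intro d _; simp
  smul_mem' := by
    intro c a ha d hd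
    simp [ha d hd]

variable {K : Type*} [Field K]

lemma mem_Q {n : ℕ} {p : PP K} :
    p ∈ Q K n ↔ ∀ d : Fin 2 →₀ ℕ, n ≤ d 0 + d 1 → coeff d p = 0 := Iff.rfl

lemma Q_mono {m n : ℕ} (h : m ≤ n) : Q K m ≤ Q K n := fun _ hp d hd => hp d (h.trans hd)

lemma monomial_mem_Q {n : ℕ} (d : Fin 2 →₀ ℕ) (a : K) (h : d 0 + d 1 < n) :
    monomial d a ∈ Q K n := by
  intro e he
  rw [coeff_monomial, if_neg]
  rintro rfl
  omega

lemma map_mem_Q {n : ℕ} (N : Submodule K (PP K)) (L : PP K →ₗ[K] PP K)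
    (h : ∀ d : Fin 2 →₀ ℕ, d 0 + d 1 < n → L (monomial d 1) ∈ N) {p : PP K} (hp : p ∈ Q K n) :
    L p ∈ N := by
  rw [p.as_sum, map_sum]
  refine Submodule.sum_mem _ fun d hd => ?_
  have : d 0 + d 1 < n := by
    by_contra hc
    exact (mem_support_iff.mp hd) (hp d (by omega))
  have e : monomial d (coeff d p) = coeff d p • monomial d (1 : K) := by
    rw [smul_monomial, smul_eq_mul, mul_one]
  rw [e, map_smul]
  exact Submodule.smul_mem _ _ (h d this)

lemma X_mul_mem_Q {n : ℕ} (i : Fin 2) {p : PP K} (hp : p ∈ Q K n) : X i * p ∈ Q K (n + 1) := by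
  refine map_mem_Q (Q K (n+1)) (LinearMap.mulLeft K (X i)) (fun d hd => ?_) hp
  rw [LinearMap.mulLeft_apply, X, monomial_mul]
  apply monomial_mem_Q
  fin_cases i <;> simp <;> omega

lemma pderiv_mem_Q {n : ℕ} {p : PP K} (hp : p ∈ Q K (n + 1)) :
    pderiv (0 : Fin 2) p ∈ Q K n := by
  refine map_mem_Q (Q K n) (pderiv (R := K) (0 : Fin 2)).toLinearMap (fun d hd => ?_) hp
  rw [Derivation.coeFn_coe, pderiv_monomial]
  by_cases h : d 0 = 0
  · simp [h]
  · apply monomial_mem_Q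
    simp
    omega

lemma mem_Q_totalDegree (p : PP K) : p ∈ Q K (p.totalDegree + 1) := by
  intro d hd
  apply coeff_eq_zero_of_totalDegree_lt
  have : ∑ i ∈ d.support, d i = d.degree := rfl
  rw [this, Finsupp.degree_eq_sum, Fin.sum_univ_two]
  omega

lemma totalDegree_le_of_mem {n : ℕ} {p : PP K} (hp : p ∈ Q K (n + 1)) : p.totalDegree ≤ n := by
  rw [totalDegree_eq]
  refine Finset.sup_le fun d hd => ?_
  have : d 0 + d 1 < n + 1 := by
    by_contra hc
    exact (mem_support_iff.mp hd) (hp d (by omega))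
  have e : Multiset.card (Finsupp.toMultiset d) = d.degree := Finsupp.card_toMultiset d
  rw [e, Finsupp.degree_eq_sum, Fin.sum_univ_two]
  omega

/-- generators -/
noncomputable def gX (K : Type*) [CommRing K] : WeylAlgebra K :=
  RingQuot.mkAlgHom K (weylRel K) (FreeAlgebra.ι K 0)
noncomputable def gY (K : Type*) [CommRing K] : WeylAlgebra K :=
  RingQuot.mkAlgHom K (weylRel K) (FreeAlgebra.ι K 1)

lemma gY_mul_gX : gY K * gX K = gX K * gY K + 1 := by
  have := RingQuot.mkAlgHom_rel K (s := weylRel K) ⟨rfl, rfl⟩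
  simpa only [gX, gY, map_mul, map_add, map_one] using this

lemma weyl_induction (S : Subalgebra K (WeylAlgebra K)) (hX : gX K ∈ S) (hY : gY K ∈ S)
    (a : WeylAlgebra K) : a ∈ S := by
  obtain ⟨f, rfl⟩ := RingQuot.mkAlgHom_surjective K (weylRel K) a
  induction f using FreeAlgebra.induction with
  | grade0 r => simpa using S.algebraMap_mem r
  | grade1 i => fin_cases i; exacts [hX, hY]
  | mul a b ha hb => rw [map_mul]; exact S.mul_mem ha hb
  | add a b ha hb => rw [map_add]; exact S.add_mem ha hb

noncomputable def opY (K : Type*) [Field K] : Module.End K (PP K) :=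
  LinearMap.mulLeft K (X 1) + (pderiv (R := K) (0 : Fin 2)).toLinearMap

noncomputable def preRho (K : Type*) [Field K] : FreeAlgebra K (Fin 2) →ₐ[K] Module.End K (PP K) :=
  FreeAlgebra.lift K (fun i => if i = 0 then (LinearMap.mulLeft K (X 0) : Module.End K (PP K)) else opY K)

lemma preRho_rel : ∀ ⦃a b⦄, weylRel K a b → preRho K a = preRho K b := by
  rintro _ _ ⟨rfl, rfl⟩
  simp only [preRho, map_mul, map_add, map_one, FreeAlgebra.lift_ι_apply]
  apply LinearMap.ext
  intro p
  simp [opY, Module.End.mul_apply, pderiv_X]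
  ring

noncomputable def rho (K : Type*) [Field K] : WeylAlgebra K →ₐ[K] Module.End K (PP K) :=
  RingQuot.liftAlgHom K ⟨preRho K, preRho_rel⟩

lemma rho_gX (p : PP K) : rho K (gX K) p = X 0 * p := by
  simp [rho, gX, RingQuot.liftAlgHom_mkAlgHom_apply, preRho]

lemma rho_gY (p : PP K) : rho K (gY K) p = X 1 * p + pderiv 0 p := by
  simp [rho, gY, RingQuot.liftAlgHom_mkAlgHom_apply, preRho, opY]

noncomputable def tau (K : Type*) [Field K] : PP K →ₗ[K] WeylAlgebra K :=
  (basisMonomials (Fin 2) K).constr K (fun d => gX K ^ (d 0) * gY K ^ (d 1))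

lemma tau_monomial (d : Fin 2 →₀ ℕ) : tau K (monomial d 1) = gX K ^ (d 0) * gY K ^ (d 1) := by
  have := (basisMonomials (Fin 2) K).constr_basis K (fun d => gX K ^ (d 0) * gY K ^ (d 1)) d
  simpa [tau] using this

lemma gY_mul_pow (n : ℕ) : gY K * gX K ^ n = gX K ^ n * gY K + (n : WeylAlgebra K) * gX K ^ (n - 1) := by
  induction n with
  | zero => simp
  | succ n ih =>
    rw [pow_succ, ← mul_assoc, ih, add_mul, mul_assoc, gY_mul_gX, mul_add, mul_one, mul_assoc]
    rcases n with _ | n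
    · simp
    · simp only [Nat.add_sub_cancel, ← pow_succ]
      push_cast
      noncomm_ring

lemma hom_eq {p : PP K} (L M : PP K →ₗ[K] WeylAlgebra K)
    (h : ∀ d : Fin 2 →₀ ℕ, L (monomial d 1) = M (monomial d 1)) : L p = M p := by
  have : L = M := by
    apply (basisMonomials (Fin 2) K).ext
    intro d
    simpa using h d
  rw [this]

lemma tau_rho (a : WeylAlgebra K) : ∀ p, tau K (rho K a p) = a * tau K p := by
  let S : Subalgebra K (WeylAlgebra K) :=
    { carrier := {a | ∀ p, tau K (rho K a p) = a * tau K p}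
      mul_mem' := by
        intro a b ha hb p
        rw [map_mul, Module.End.mul_apply, ha, hb, mul_assoc]
      add_mem' := by
        intro a b ha hb p
        rw [map_add, LinearMap.add_apply, map_add, ha, hb, add_mul]
      algebraMap_mem' := by
        intro r p
        rw [AlgHom.commutes, Module.algebraMap_end_apply, map_smul, Algebra.smul_def] }
  refine weyl_induction S ?_ ?_ a
  · intro p
    simp only [rho_gX]
    refine hom_eq ((tau K).comp (LinearMap.mulLeft K (X 0)))
      ((LinearMap.mulLeft K (gX K)).comp (tau K)) (fun d => ?_)
    simp only [LinearMap.comp_apply, LinearMap.mulLeft_apply]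
    rw [X, monomial_mul, mul_one, tau_monomial, tau_monomial]
    simp [add_comm 1, pow_succ', mul_assoc]
  · intro p
    simp only [rho_gY]
    refine hom_eq ((tau K).comp (opY K))
      ((LinearMap.mulLeft K (gY K)).comp (tau K)) (fun d => ?_)
    simp only [LinearMap.comp_apply, LinearMap.mulLeft_apply, opY, LinearMap.add_apply,
      Derivation.coeFn_coe, pderiv_monomial, map_add]
    have e : monomial (d - Finsupp.single 0 1) (1 * (d 0 : K)) =
        (d 0 : K) • monomial (d - Finsupp.single 0 1) (1 : K) := by
      rw [smul_monomial, smul_eq_mul, mul_one, one_mul]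
    rw [e, map_smul, X, monomial_mul, mul_one, tau_monomial, tau_monomial, tau_monomial,
      ← mul_assoc, gY_mul_pow, add_mul, Algebra.smul_def]
    simp [add_comm 1, pow_succ', mul_assoc]

noncomputable def sig (a : WeylAlgebra K) : PP K := rho K a 1

lemma tau_sig (a : WeylAlgebra K) : tau K (sig a) = a := by
  rw [sig, tau_rho]
  have : (1 : PP K) = monomial 0 1 := rfl
  rw [this, tau_monomial]; simp

lemma sig_mul (a b : WeylAlgebra K) : sig (a * b) = rho K a (sig b) := by
  simp [sig, Module.End.mul_apply]

lemma sig_inj {a b : WeylAlgebra K} (h : sig a = sig b) : a = b := by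
  rw [← tau_sig a, h, tau_sig]

lemma sig_zero : sig (0 : WeylAlgebra K) = 0 := by simp [sig]
lemma sig_one : sig (1 : WeylAlgebra K) = 1 := by simp [sig]

lemma rhoY_pow {n : ℕ} {q : PP K} (hq : q ∈ Q K (n + 1)) (j : ℕ) :
    rho K (gY K ^ j) q - X 1 ^ j * q ∈ Q K (n + j) ∧ X 1 ^ j * q ∈ Q K (n + j + 1) := by
  induction j with
  | zero => simp; exact hq
  | succ j ih =>
    obtain ⟨h1, h2⟩ := ih
    constructor
    · have h3 : rho K (gY K ^ j) q ∈ Q K (n + j + 1) := by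
        have := Submodule.add_mem _ (Q_mono (by omega) h1 : _ ∈ Q K (n+j+1)) h2
        simpa using this
      rw [pow_succ', map_mul, Module.End.mul_apply, rho_gY]
      have := Submodule.add_mem _ (X_mul_mem_Q 1 h1) (Q_mono (by omega) (pderiv_mem_Q h3))
      have e : X 1 * rho K (gY K ^ j) q + pderiv 0 (rho K (gY K ^ j) q) - X 1 ^ (j + 1) * q =
          X 1 * (rho K (gY K ^ j) q - X 1 ^ j * q) + pderiv 0 (rho K (gY K ^ j) q) := by
        generalize rho K (gY K ^ j) q = r
        rw [mul_sub, pow_succ', mul_assoc]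
        abel
      rw [e]
      exact this
    · rw [pow_succ', mul_assoc]
      exact X_mul_mem_Q 1 h2

lemma rhoX_pow {n : ℕ} {q q' : PP K} (hq : q - q' ∈ Q K n) (j : ℕ) :
    rho K (gX K ^ j) q - X 0 ^ j * q' ∈ Q K (n + j) := by
  induction j with
  | zero => simpa
  | succ j ih =>
    rw [pow_succ', map_mul, Module.End.mul_apply, rho_gX, pow_succ', mul_assoc, ← mul_sub]
    exact X_mul_mem_Q 0 ih

lemma rho_tau {m n : ℕ} {p q : PP K} (hp : p ∈ Q K (m + 1)) (hq : q ∈ Q K (n + 1)) :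
    rho K (tau K p) q - p * q ∈ Q K (n + m) := by
  refine map_mem_Q (Q K (n+m)) (((LinearMap.applyₗ q).comp ((rho K).toLinearMap.comp (tau K)))
    - LinearMap.mulRight K q) (fun d hd => ?_) hp
  simp only [LinearMap.sub_apply, LinearMap.comp_apply, LinearMap.applyₗ_apply_apply,
    AlgHom.toLinearMap_apply, LinearMap.mulRight_apply, tau_monomial, map_mul,
    Module.End.mul_apply]
  have := rhoX_pow (rhoY_pow hq (d 1)).1 (d 0)
  have e : (monomial d (1:K)) = X 0 ^ (d 0) * X 1 ^ (d 1) := by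
    rw [monomial_eq, Finsupp.prod_fintype _ _ (by simp)]
    simp
  rw [e, mul_assoc]
  exact Q_mono (by omega) this

noncomputable def deg (a : WeylAlgebra K) : ℕ := (sig a).totalDegree

lemma sig_ne {a : WeylAlgebra K} (ha : a ≠ 0) : sig a ≠ 0 := fun h =>
  ha (sig_inj (h.trans sig_zero.symm))

lemma deg_mul_aux {a b : WeylAlgebra K} (ha : a ≠ 0) (hb : b ≠ 0) :
    a * b ≠ 0 ∧ deg (a * b) = deg a + deg b := by
  have h1 := rho_tau (mem_Q_totalDegree (sig a)) (mem_Q_totalDegree (sig b))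
  rw [tau_sig, ← sig_mul] at h1
  have h2 := totalDegree_mul_of_isDomain (sig_ne ha) (sig_ne hb)
  have h0 := mul_ne_zero (sig_ne ha) (sig_ne hb)
  have hle : sig (a * b) ∈ Q K (deg a + deg b + 1) := by
    have := Submodule.add_mem _ (Q_mono (by unfold deg; omega) h1 : _ ∈ Q K (deg a + deg b + 1))
      (Q_mono (by unfold deg; omega) (mem_Q_totalDegree (sig a * sig b)))
    simpa using this
  have hle' := totalDegree_le_of_mem hle
  have key : sig (a * b) ∉ Q K (deg a + deg b) := by
    intro hc
    have h3 : sig a * sig b ∈ Q K (deg a + deg b) := by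
      have := Submodule.sub_mem _ hc (Q_mono (by unfold deg; omega) h1 : _ ∈ Q K (deg a + deg b))
      simpa using this
    rcases hd : deg a + deg b with _ | k
    · rw [hd] at h3
      apply h0
      ext d
      exact h3 d (by omega)
    · rw [hd] at h3
      have := totalDegree_le_of_mem h3
      unfold deg at hd
      omega
  constructor
  · intro h
    rw [h, sig_zero] at key
    exact key (Submodule.zero_mem _)
  · refine le_antisymm hle' ?_
    by_contra hc
    exact key (Q_mono (by unfold deg at hc ⊢; omega) (mem_Q_totalDegree (sig (a * b))))

lemma deg_mul_le (a b : WeylAlgebra K) : deg (a * b) ≤ deg a + deg b := by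
  by_cases ha : a = 0
  · simp [ha, deg, sig_zero]
  by_cases hb : b = 0
  · simp [hb, deg, sig_zero]
  exact (deg_mul_aux ha hb).2.le

lemma deg_pow_le (a : WeylAlgebra K) (n : ℕ) : deg (a ^ n) ≤ n * deg a := by
  induction n with
  | zero => simp [deg, sig_one]
  | succ n ih =>
    rw [pow_succ, add_mul, one_mul]
    exact (deg_mul_le _ _).trans (by omega)

instance : NoZeroDivisors (WeylAlgebra K) where
  eq_zero_or_eq_zero_of_mul_eq_zero := by
    intro a b h
    by_contra! hc
    exact (deg_mul_aux hc.1 hc.2).1 h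

instance : Nontrivial (WeylAlgebra K) := ⟨0, 1, fun h => by
  have := congrArg sig h
  rw [sig_zero, sig_one] at this
  exact zero_ne_one this⟩

lemma sig_algebraMap (k : K) : sig (algebraMap K (WeylAlgebra K) k) = C k := by
  rw [sig, AlgHom.commutes, Module.algebraMap_end_apply, ← C_mul', mul_one]

lemma deg_algebraMap (k : K) : deg (algebraMap K (WeylAlgebra K) k) = 0 := by
  rw [deg, sig_algebraMap, totalDegree_C]

lemma eq_algebraMap_of_deg {a : WeylAlgebra K} (h : deg a = 0) :
    ∃ k : K, a = algebraMap K _ k := by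
  rw [deg, totalDegree_eq_zero_iff_eq_C] at h
  exact ⟨_, sig_inj (h.trans (sig_algebraMap _).symm)⟩

lemma sum_indep [CharZero K] (δ : WeylAlgebra K →ₗ[K] WeylAlgebra K)
    (hδ : ∀ a b, δ (a * b) = δ a * b + a * δ b) (u : WeylAlgebra K) (hu : δ u = 1) (n : ℕ) :
    ∀ c : ℕ → WeylAlgebra K, (∀ i, δ (c i) = 0) → ∑ i ∈ Finset.range n, c i * u ^ i = 0 →
      ∀ i < n, c i = 0 := by
  have h1 : δ 1 = 0 := by
    have := hδ 1 1
    simpa using this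
  have hp : ∀ i : ℕ, δ (u ^ (i + 1)) = ((i : K) + 1) • u ^ i := by
    intro i
    induction i with
    | zero => simp [hu]
    | succ i ih =>
      rw [pow_succ, hδ, ih, hu, mul_one, smul_mul_assoc, ← pow_succ]
      push_cast
      module
  induction n with
  | zero => intro c _ _ i hi; omega
  | succ n ih =>
    intro c hc h
    rw [Finset.sum_range_succ'] at h
    have h2 := congrArg δ h
    rw [map_add, map_sum, pow_zero, mul_one, hc 0, add_zero, map_zero] at h2
    have h3 := ih (fun i => ((i : K) + 1) • c (i + 1)) (fun i => by simp [hc]) (by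
      rw [← h2]
      refine Finset.sum_congr rfl fun i _ => ?_
      rw [hδ, hc, zero_mul, zero_add, hp, smul_mul_assoc, mul_smul_comm])
    have h4 : ∀ i < n, c (i + 1) = 0 := by
      intro i hi
      have := h3 i hi
      rcases smul_eq_zero.mp this with h | h
      · exact absurd h (Nat.cast_add_one_ne_zero i)
      · exact h
    rw [Finset.sum_eq_zero (fun i hi => by rw [h4 i (Finset.mem_range.mp hi), zero_mul])] at h
    intro i hi
    rcases i with _ | i
    · simpa using h
    · exact h4 i (by omega)

lemma pow_indep {z : WeylAlgebra K} (hz : 0 < deg z) (n : ℕ) :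
    ∀ c : ℕ → K, ∑ i ∈ Finset.range n, c i • z ^ i = 0 → ∀ i < n, c i = 0 := by
  induction n with
  | zero => intro c _ i hi; omega
  | succ n ih =>
    intro c h
    rw [Finset.sum_range_succ'] at h
    have e : ∑ i ∈ Finset.range n, c (i + 1) • z ^ (i + 1) =
        z * ∑ i ∈ Finset.range n, c (i + 1) • z ^ i := by
      rw [Finset.mul_sum]
      refine Finset.sum_congr rfl fun i _ => ?_
      rw [mul_smul_comm, pow_succ']
    rw [e] at h
    have h0 : ∑ i ∈ Finset.range n, c (i + 1) • z ^ i = 0 := by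
      by_contra hne
      have hz0 : z ≠ 0 := by
        rintro rfl
        simp [deg, sig_zero] at hz
      have hd := (deg_mul_aux hz0 hne).2
      have : z * ∑ i ∈ Finset.range n, c (i + 1) • z ^ i = algebraMap K _ (- c 0) := by
        rw [eq_neg_of_add_eq_zero_left h, pow_zero, map_neg, Algebra.smul_def, mul_one]
      rw [this, deg_algebraMap] at hd
      omega
    have h4 := ih (fun i => c (i + 1)) h0
    rw [h0, mul_zero, zero_add, pow_zero] at h
    intro i hi
    rcases i with _ | i
    · simpa using h
    · exact h4 i (by omega)

lemma comm_leibniz {R : Type*} [Ring R] (u a b : R) :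
    u * (a * b) - a * b * u = (u * a - a * u) * b + a * (u * b - b * u) := by
  noncomm_ring

lemma gen_neg {R : Type*} [Ring R] (p a q b : R) : -(p * b + a * q) = -p * b + a * -q := by
  noncomm_ring

lemma gen_adxy {R : Type*} [Ring R] [Algebra K R] {x y : R} (h : y * x - x * y = 1) :
    x * y - y * x = (-1 : K) • 1 := by
  rw [← neg_sub, h, neg_one_smul]

lemma gen_adhy {R : Type*} [Ring R] [Algebra K R] {x y : R} (h : y * x - x * y = 1) :
    y * x * y - y * (y * x) = (-1 : K) • y := by
  rw [mul_assoc, ← mul_sub, ← neg_sub, h, neg_one_smul, mul_neg, mul_one]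

lemma gen_sub {R : Type*} [Ring R] [Algebra K R] {a b : R} {m : K} (h : a + b = m • b) :
    a = (m - 1) • b := by
  rw [sub_smul, one_smul, ← h, add_sub_cancel_right]

lemma gen_swap {R : Type*} [Ring R] {x y : R} (h : y * x - x * y = 1) :
    (-x) * y - y * (-x) = 1 := by
  rw [← h]; noncomm_ring

lemma gen_cent {R : Type*} [Ring R] [Algebra K R] {x y c : R} {m : K} (h : y * x - x * y = 1)
    (hc : y * c = c * y) (he : y * x * c - c * (y * x) = m • c) :
    (-x * c - c * (-x)) * y = (-m) • c := by
  rw [neg_smul, ← he]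
  have e : y * x = x * y + 1 := by rw [← h]; abel
  rw [e, sub_mul, mul_assoc (-x) c, ← hc]
  noncomm_ring

lemma comm_jacobi {R : Type*} [Ring R] (h u c : R) :
    h * (u * c - c * u) - (u * c - c * u) * h =
      ((h * u - u * h) * c - c * (h * u - u * h)) + (u * (h * c - c * h) - (h * c - c * h) * u) := by
  noncomm_ring

noncomputable def ad (u : WeylAlgebra K) : Module.End K (WeylAlgebra K) :=
  LinearMap.mulLeft K u - LinearMap.mulRight K u

lemma ad_apply (u c : WeylAlgebra K) : ad u c = u * c - c * u := rfl

lemma ad_mul (u a b : WeylAlgebra K) : ad u (a * b) = ad u a * b + a * ad u b := by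
  exact comm_leibniz u a b

noncomputable def sigL (K : Type*) [Field K] : WeylAlgebra K →ₗ[K] PP K :=
  (LinearMap.applyₗ (1 : PP K)).comp (rho K).toLinearMap

lemma sigL_apply (a : WeylAlgebra K) : sigL K a = sig a := rfl

lemma trivar_indep [CharZero K] {x y z : WeylAlgebra K} (hxy : y * x - x * y = 1) (hzx : z * x = x * z)
    (hzy : z * y = y * z) (hz : 0 < deg z) (n : ℕ) (c : ℕ → ℕ → ℕ → K)
    (h : ∑ j ∈ Finset.range n, (∑ i ∈ Finset.range n, (∑ k ∈ Finset.range n, c i j k • z ^ k) * x ^ i)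
      * y ^ j = 0) : ∀ i < n, ∀ j < n, ∀ k < n, c i j k = 0 := by
  have hzx' : Commute x z := hzx.symm
  have hzy' : Commute y z := hzy.symm
  have h1 := sum_indep (-ad x) (by intro a b; rw [LinearMap.neg_apply, ad_mul]; exact gen_neg _ _ _ _) y
    (by simpa [ad_apply] using hxy) n _ (fun j => by
      rw [LinearMap.neg_apply, ad_apply, neg_eq_zero, sub_eq_zero]
      refine Commute.eq (Commute.sum_right _ _ _ fun i _ => ?_)
      exact (Commute.sum_right _ _ _ fun k _ => (hzx'.pow_right k).smul_right _).mul_right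
        ((Commute.refl x).pow_right i)) h
  intro i hi j hj
  have h2 := sum_indep (ad y) (ad_mul y) x hxy n _ (fun i => by
      rw [ad_apply, sub_eq_zero]
      exact Commute.eq (Commute.sum_right _ _ _ fun k _ => (hzy'.pow_right k).smul_right _))
      (h1 j hj) i hi
  exact pow_indep hz n _ h2

lemma sum_mem_deg {x y z : WeylAlgebra K} {N M i j k : ℕ} (hi : i ≤ N) (hj : j ≤ N) (hk : k ≤ N)
    (hM : N * (deg x + deg y + deg z) ≤ M) :
    sig (z ^ k * x ^ i * y ^ j) ∈ Q K (M + 1) := by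
  refine Q_mono ?_ (mem_Q_totalDegree _)
  have h1 := deg_mul_le (z ^ k * x ^ i) (y ^ j)
  have h2 := deg_mul_le (z ^ k) (x ^ i)
  have h3 := (deg_pow_le z k).trans (Nat.mul_le_mul_right _ hk)
  have h4 := (deg_pow_le x i).trans (Nat.mul_le_mul_right _ hi)
  have h5 := (deg_pow_le y j).trans (Nat.mul_le_mul_right _ hj)
  unfold deg at *
  nlinarith

lemma central_scalar [CharZero K] {x y z : WeylAlgebra K} (hxy : y * x - x * y = 1) (hzx : z * x = x * z)
    (hzy : z * y = y * z) : ∃ k : K, z = algebraMap K _ k := by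
  apply eq_algebraMap_of_deg
  by_contra hz
  replace hz : 0 < deg z := Nat.pos_of_ne_zero hz
  obtain ⟨D, hD⟩ : ∃ D, D = deg x + deg y + deg z := ⟨_, rfl⟩
  have hD0 : 1 ≤ D := by omega
  let N := D ^ 2 + 1
  let M := D ^ 2 * D
  let G : (Fin N × Fin N × Fin N → K) →ₗ[K] WeylAlgebra K :=
    Fintype.linearCombination K (fun t => z ^ (t.2.2 : ℕ) * x ^ (t.1 : ℕ) * y ^ (t.2.1 : ℕ))
  let e : Fin (M + 1) × Fin (M + 1) → (Fin 2 →₀ ℕ) := fun ab =>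
    Finsupp.equivFunOnFinite.symm ![ab.1, ab.2]
  let F : (Fin N × Fin N × Fin N → K) →ₗ[K] (Fin (M + 1) × Fin (M + 1) → K) :=
    LinearMap.pi (fun ab => (lcoeff K (e ab)).comp ((sigL K).comp G))
  have hlt : Module.finrank K (Fin (M + 1) × Fin (M + 1) → K) <
      Module.finrank K (Fin N × Fin N × Fin N → K) := by
    simp only [Module.finrank_fintype_fun_eq_card, Fintype.card_prod, Fintype.card_fin, N, M]
    have : D ^ 3 ≤ D ^ 4 := Nat.pow_le_pow_right hD0 (by norm_num)
    have : 0 < D ^ 2 := by positivity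
    ring_nf
    nlinarith
  obtain ⟨v, hv, hv0⟩ := Submodule.exists_mem_ne_zero_of_ne_bot
    (LinearMap.ker_ne_bot_of_finrank_lt (f := F) hlt)
  apply hv0
  rw [LinearMap.mem_ker] at hv
  have hGv : G v = ∑ t, v t • (z ^ (t.2.2 : ℕ) * x ^ (t.1 : ℕ) * y ^ (t.2.1 : ℕ)) := by
    simp [G, Fintype.linearCombination_apply]
  have hQ : sig (G v) ∈ Q K (M + 1) := by
    rw [← sigL_apply, hGv, map_sum]
    refine Submodule.sum_mem _ fun t _ => ?_
    rw [map_smul, sigL_apply]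
    refine Submodule.smul_mem _ _ (sum_mem_deg (N := D ^ 2) ?_ ?_ ?_ ?_)
    · have := t.1.2; omega
    · have := t.2.1.2; omega
    · have := t.2.2.2; omega
    · rw [← hD]
  have hG0 : G v = 0 := by
    apply sig_inj
    rw [sig_zero]
    ext d
    by_cases hd : M + 1 ≤ d 0 + d 1
    · exact hQ d hd
    · have := congrFun hv (⟨d 0, by omega⟩, ⟨d 1, by omega⟩)
      have he : e (⟨d 0, by omega⟩, ⟨d 1, by omega⟩) = d := by
        ext i
        fin_cases i <;> simp [e]
      simp only [F, LinearMap.pi_apply, LinearMap.comp_apply, he, sigL_apply] at this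
      simpa using this
  let c : ℕ → ℕ → ℕ → K := fun i j k =>
    if h : i < N ∧ j < N ∧ k < N then v (⟨i, h.1⟩, ⟨j, h.2.1⟩, ⟨k, h.2.2⟩) else 0
  have hc := trivar_indep hxy hzx hzy hz N c (by
    simp only [Finset.sum_range]
    rw [← hG0, hGv, Fintype.sum_prod_type]
    simp only [Fintype.sum_prod_type]
    rw [Finset.sum_comm]
    refine Finset.sum_congr rfl fun j _ => ?_
    simp only [Finset.sum_mul]
    refine Finset.sum_congr rfl fun i _ => ?_
    refine Finset.sum_congr rfl fun k _ => ?_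
    simp [c])
  ext ⟨i, j, k⟩
  have := hc i i.2 j j.2 k k.2
  simpa [c] using this

lemma ad_jacobi (h u c : WeylAlgebra K) : ad h (ad u c) = ad (ad h u) c + ad u (ad h c) :=
  comm_jacobi h u c

lemma ad_smul (s : K) (u c : WeylAlgebra K) : ad (s • u) c = s • ad u c := by
  simp only [ad_apply, smul_mul_assoc, mul_smul_comm, smul_sub]

lemma ad_one (c : WeylAlgebra K) : ad 1 c = 0 := by simp [ad_apply]

lemma ad_one' (c : WeylAlgebra K) : ad c 1 = 0 := by simp [ad_apply]

lemma ad_pow_eig {u v : WeylAlgebra K} {s : K} (h : ad u v = s • v) (i : ℕ) :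
    ad u (v ^ i) = ((i : K) * s) • v ^ i := by
  induction i with
  | zero => simp [ad_one']
  | succ i ih =>
    rw [pow_succ, ad_mul, ih, h, smul_mul_assoc, mul_smul_comm]
    push_cast
    module

lemma ad_pow_scal {u v : WeylAlgebra K} {s : K} (h : ad u v = s • 1) (i : ℕ) :
    ad u (v ^ (i + 1)) = (((i : K) + 1) * s) • v ^ i := by
  induction i with
  | zero => simp [h]
  | succ i ih =>
    rw [pow_succ, ad_mul, ih, h, smul_mul_assoc, mul_smul_comm, ← pow_succ, mul_one]
    push_cast
    module

section
variable {x y : WeylAlgebra K}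

lemma adyx (hxy : y * x - x * y = 1) : ad y x = (1 : K) • 1 := by rw [ad_apply, hxy, one_smul]

lemma adxy (hxy : y * x - x * y = 1) : ad x y = (-1 : K) • 1 := gen_adxy hxy

lemma adhx (hxy : y * x - x * y = 1) : ad (y * x) x = (1 : K) • x := by
  rw [ad_apply, one_smul, ← mul_assoc, ← sub_mul, hxy, one_mul]

lemma adhy (hxy : y * x - x * y = 1) : ad (y * x) y = (-1 : K) • y := gen_adhy hxy

lemma ad_xy_comm (hxy : y * x - x * y = 1) (c : WeylAlgebra K) : ad x (ad y c) = ad y (ad x c) := by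
  rw [ad_jacobi, adxy hxy, ad_smul, ad_one, smul_zero, zero_add]

lemma deg_x_pos (hxy : y * x - x * y = 1) : 0 < deg x := by
  by_contra h
  obtain ⟨k, rfl⟩ := eq_algebraMap_of_deg (a := x) (by omega)
  rw [Algebra.commutes, sub_self] at hxy
  exact zero_ne_one hxy

lemma case_one [CharZero K] (hxy : y * x - x * y = 1) (n : ℕ) : ∀ (c : WeylAlgebra K) (μ : K),
    deg c < n → ad x c = 0 → ad y c * x = μ • c →
    c = 0 ∨ ∃ (m : ℕ) (α : K), μ = m ∧ c = α • x ^ m := by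
  have hx0 : x ≠ 0 := by
    rintro rfl
    simp at hxy
  induction n with
  | zero => intro c μ h; omega
  | succ n ih =>
    intro c μ hd hc he
    by_cases hc0 : c = 0
    · exact Or.inl hc0
    by_cases hμ : μ = 0
    · right
      rw [hμ, zero_smul] at he
      have h1 : ad y c = 0 := (mul_eq_zero.mp he).resolve_right hx0
      rw [ad_apply, sub_eq_zero] at h1 hc
      obtain ⟨k, hk⟩ := central_scalar hxy hc.symm h1.symm
      refine ⟨0, k, by simpa using hμ, ?_⟩
      rw [hk, pow_zero, Algebra.smul_def, mul_one]
    · have hcc : c = μ⁻¹ • (ad y c * x) := by rw [he, smul_smul, inv_mul_cancel₀ hμ, one_smul]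
      have he0 : ad y c ≠ 0 := by
        intro h
        rw [h, zero_mul, smul_zero] at hcc
        exact hc0 hcc
      have hdeg : deg (ad y c) < n := by
        have h1 := (deg_mul_aux he0 hx0).2
        have h2 : deg (ad y c * x) ≤ deg c := by
          rw [he, Algebra.smul_def]
          refine (deg_mul_le _ _).trans ?_
          rw [deg_algebraMap, zero_add]
        have := deg_x_pos hxy
        omega
      have h1 : ad x (ad y c) = 0 := by rw [ad_xy_comm hxy, hc, map_zero]
      have h2 : ad y (ad y c) * x = (μ - 1) • ad y c := by
        have := congrArg (ad y) he
        rw [ad_mul, adyx hxy, one_smul, mul_one, map_smul] at this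
        exact gen_sub this
      rcases ih _ _ hdeg h1 h2 with h | ⟨m, α, hm, hα⟩
      · exact absurd h he0
      · right
        refine ⟨m + 1, μ⁻¹ * α, ?_, ?_⟩
        · push_cast; rw [← hm]; ring
        · rw [hcc, hα, smul_mul_assoc, ← pow_succ, smul_smul]

lemma cent_x [CharZero K] (hxy : y * x - x * y = 1) {c : WeylAlgebra K} {μ : K}
    (hc : ad x c = 0) (he : ad (y * x) c = μ • c) :
    c = 0 ∨ ∃ (m : ℕ) (α : K), μ = m ∧ c = α • x ^ m := by
  refine case_one hxy (deg c + 1) c μ (by omega) hc ?_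
  rw [← he]
  rw [ad_apply, sub_eq_zero] at hc
  rw [ad_apply, ad_apply, sub_mul, mul_assoc y c, ← hc, mul_assoc, mul_assoc]

lemma cent_y [CharZero K] (hxy : y * x - x * y = 1) {c : WeylAlgebra K} {μ : K}
    (hc : ad y c = 0) (he : ad (y * x) c = μ • c) :
    c = 0 ∨ ∃ (m : ℕ) (α : K), -μ = m ∧ c = α • y ^ m := by
  have hxy' : (-x) * y - y * (-x) = 1 := gen_swap hxy
  refine case_one hxy' (deg c + 1) c (-μ) (by omega) hc ?_
  rw [ad_apply, sub_eq_zero] at hc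
  exact gen_cent hxy hc he

def W (x y : WeylAlgebra K) (l : K) : Submodule K (WeylAlgebra K) :=
  Submodule.span K {w | ∃ i j : ℕ, (i : K) - (j : K) = l ∧ w = x ^ i * y ^ j}

lemma W_le (l : K) {w : WeylAlgebra K} (hw : w ∈ W x y l) :
    w ∈ Algebra.adjoin K ({x, y} : Set (WeylAlgebra K)) := by
  have : W x y l ≤ Subalgebra.toSubmodule (Algebra.adjoin K ({x, y} : Set (WeylAlgebra K))) := by
    refine Submodule.span_le.mpr ?_
    rintro _ ⟨i, j, _, rfl⟩
    exact Subalgebra.mul_mem _ (Subalgebra.pow_mem _ (Algebra.subset_adjoin (by simp)) _)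
      (Subalgebra.pow_mem _ (Algebra.subset_adjoin (by simp)) _)
  exact this hw

lemma W_eig (hxy : y * x - x * y = 1) (l : K) {w : WeylAlgebra K} (hw : w ∈ W x y l) :
    ad (y * x) w = l • w := by
  induction hw using Submodule.span_induction with
  | mem w hw =>
    obtain ⟨i, j, h, rfl⟩ := hw
    rw [ad_mul, ad_pow_eig (adhx hxy), ad_pow_eig (adhy hxy), ← h, smul_mul_assoc, mul_smul_comm]
    module
  | zero => simp
  | add a b _ _ ha hb => rw [map_add, ha, hb, smul_add]
  | smul k a _ ha => rw [map_smul, ha, smul_comm]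

lemma W_surj [CharZero K] (hxy : y * x - x * y = 1) (l : K) {w : WeylAlgebra K} (hw : w ∈ W x y l) :
    ∃ a ∈ W x y l, ad x (ad y a) = w := by
  induction hw using Submodule.span_induction with
  | mem w hw =>
    obtain ⟨i, j, h, rfl⟩ := hw
    refine ⟨(-(((i : K) + 1) * ((j : K) + 1))⁻¹) • (x ^ (i + 1) * y ^ (j + 1)),
      Submodule.smul_mem _ _ (Submodule.subset_span ⟨i + 1, j + 1, by push_cast; rw [← h]; ring, rfl⟩), ?_⟩
    have h1 : (i : K) + 1 ≠ 0 := Nat.cast_add_one_ne_zero i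
    have h2 : (j : K) + 1 ≠ 0 := Nat.cast_add_one_ne_zero j
    have hyy : ad y y = (0 : K) • y := by simp [ad_apply]
    have hxx : ad x x = (0 : K) • x := by simp [ad_apply]
    rw [map_smul, map_smul, ad_mul, ad_pow_scal (adyx hxy), ad_pow_eig hyy, mul_zero, zero_smul,
      mul_zero, add_zero, smul_mul_assoc, map_smul, ad_mul, ad_pow_scal (adxy hxy),
      ad_pow_eig hxx, mul_zero, zero_smul, zero_mul, zero_add, mul_smul_comm, smul_smul, smul_smul]
    have : -(((i : K) + 1) * ((j : K) + 1))⁻¹ * (((i : K) + 1) * 1 * (((j : K) + 1) * -1)) = 1 := by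
      field_simp
    rw [← mul_assoc] at this
    rw [this, one_smul]
  | zero => exact ⟨0, Submodule.zero_mem _, by simp⟩
  | add a b _ _ ha hb =>
    obtain ⟨a', ha', rfl⟩ := ha
    obtain ⟨b', hb', rfl⟩ := hb
    exact ⟨a' + b', Submodule.add_mem _ ha' hb', by simp⟩
  | smul k a _ ha =>
    obtain ⟨a', ha', rfl⟩ := ha
    exact ⟨k • a', Submodule.smul_mem _ _ ha', by simp⟩

lemma main_step [CharZero K] (hxy : y * x - x * y = 1) (l : K) (n : ℕ) : ∀ b : WeylAlgebra K,
    ad (y * x) b = l • b → ((ad x * ad y) ^ n) b = 0 → b ∈ W x y l := by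
  have hay : ∀ {b : WeylAlgebra K}, ad (y * x) b = l • b → ad (y * x) (ad y b) = (l - 1) • ad y b := by
    intro b hb
    rw [ad_jacobi, adhy hxy, ad_smul, hb, map_smul]
    module
  induction n with
  | zero =>
    intro b _ h
    have : b = 0 := by simpa using h
    rw [this]; exact Submodule.zero_mem _
  | succ n ih =>
    intro b hb h
    rw [pow_succ, Module.End.mul_apply, Module.End.mul_apply] at h
    have h1 : ad (y * x) (ad x (ad y b)) = l • ad x (ad y b) := by
      rw [ad_jacobi, adhx hxy, ad_smul, hay hb, map_smul]
      module
    obtain ⟨a, ha, hab⟩ := W_surj hxy l (ih _ h1 h)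
    obtain ⟨c, hc⟩ : ∃ c, c = b - a := ⟨_, rfl⟩
    have hce : ad (y * x) c = l • c := by rw [hc, map_sub, hb, W_eig hxy l ha, smul_sub]
    have hcx : ad x (ad y c) = 0 := by rw [hc, map_sub, map_sub, hab, sub_self]
    have h2 : ∃ a2 ∈ W x y l, ad y (c - a2) = 0 := by
      rcases cent_x hxy hcx (hay hce) with h0 | ⟨m, α, hm, hα⟩
      · exact ⟨0, Submodule.zero_mem _, by rw [sub_zero, h0]⟩
      · refine ⟨(α * ((m : K) + 1)⁻¹) • x ^ (m + 1), Submodule.smul_mem _ _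
          (Submodule.subset_span ⟨m + 1, 0, ?_, by simp⟩), ?_⟩
        · push_cast; rw [← hm]; ring
        · have h1 : (m : K) + 1 ≠ 0 := Nat.cast_add_one_ne_zero m
          rw [map_sub, hα, map_smul, ad_pow_scal (adyx hxy), smul_smul, mul_one, mul_assoc,
            inv_mul_cancel₀ h1, mul_one, sub_self]
    obtain ⟨a2, ha2, h3⟩ := h2
    have h4 : c - a2 ∈ W x y l := by
      have he : ad (y * x) (c - a2) = l • (c - a2) := by
        rw [map_sub, hce, W_eig hxy l ha2, smul_sub]
      rcases cent_y hxy h3 he with h0 | ⟨m, α, hm, hα⟩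
      · rw [h0]; exact Submodule.zero_mem _
      · rw [hα]
        refine Submodule.smul_mem _ _ (Submodule.subset_span ⟨0, m, ?_, by simp⟩)
        rw [← hm]; simp
    have h5 : b = a + ((c - a2) + a2) := by rw [hc]; abel
    rw [h5]
    exact Submodule.add_mem _ ha (Submodule.add_mem _ h4 ha2)

lemma nil_mul {u g : WeylAlgebra K} {s : K} (hg : ad u g = s • 1) (n : ℕ) :
    ∀ c : WeylAlgebra K, (ad u ^ n) c = 0 → (ad u ^ (n + 1)) (g * c) = 0 := by
  induction n with
  | zero => intro c h; have : c = 0 := by simpa using h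
            simp [this]
  | succ n ih =>
    intro c h
    rw [pow_succ, Module.End.mul_apply, ad_mul, hg, smul_mul_assoc, one_mul, map_add, map_smul, h,
      smul_zero, zero_add]
    apply ih
    rw [pow_succ, Module.End.mul_apply] at h
    exact h

lemma nil_adjoin {u : WeylAlgebra K} {S : Set (WeylAlgebra K)}
    (hS : ∀ g ∈ S, ∃ s : K, ad u g = s • 1) {b : WeylAlgebra K} (hb : b ∈ Algebra.adjoin K S) :
    ∀ c : WeylAlgebra K, (∃ n, (ad u ^ n) c = 0) → ∃ n, (ad u ^ n) (b * c) = 0 := by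
  induction hb using Algebra.adjoin_induction with
  | mem g hg =>
    rintro c ⟨n, hn⟩
    obtain ⟨s, hs⟩ := hS g hg
    exact ⟨n + 1, nil_mul hs n c hn⟩
  | algebraMap r =>
    rintro c ⟨n, hn⟩
    refine ⟨n, ?_⟩
    rw [← Algebra.smul_def, map_smul, hn, smul_zero]
  | add a b _ _ ha hb =>
    intro c hc
    obtain ⟨n, hn⟩ := ha c hc
    obtain ⟨m, hm⟩ := hb c hc
    refine ⟨n + m, ?_⟩
    rw [add_mul, map_add]
    nth_rw 1 [add_comm n m]
    rw [pow_add, pow_add, Module.End.mul_apply, Module.End.mul_apply, hn, hm]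
    simp
  | mul a b _ _ ha hb =>
    intro c hc
    rw [mul_assoc]
    exact ha _ (hb c hc)

lemma nil_adjoin' {u : WeylAlgebra K} {S : Set (WeylAlgebra K)}
    (hS : ∀ g ∈ S, ∃ s : K, ad u g = s • 1) {b : WeylAlgebra K} (hb : b ∈ Algebra.adjoin K S) :
    ∃ n, 1 ≤ n ∧ (ad u ^ n) b = 0 := by
  obtain ⟨n, hn⟩ := nil_adjoin hS hb 1 ⟨1, by simp [ad_one']⟩
  refine ⟨n + 1, by omega, ?_⟩
  rw [mul_one] at hn
  rw [pow_succ', Module.End.mul_apply, hn, map_zero]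

end

end WeylAux

/-- **Corollary 2.7.** Suppose `[y,x] = 1` for elements `x, y` of the Weyl algebra `A₁`
over a field `K` of characteristic zero; let `A₁' := K⟨x,y⟩`, `δ_x := ad(x)`,
`δ_y := ad(y)` and `h := yx`. Then the following are equivalent:
(a) `D(h) = A₁'`;
(b) `δ_x` is locally nilpotent on `D(h)`;
(c) `δ_y` is locally nilpotent on `D(h)`;
(d) `δ_x ∘ δ_y` is locally nilpotent on `D(h)`. -/
theorem eigenvectorAlgebra_tfae (K : Type*) [Field K] [CharZero K]
    (x y : WeylAlgebra K) (hxy : y * x - x * y = 1) :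
    ((eigenvectorAlgebra K (y * x) = Algebra.adjoin K ({x, y} : Set (WeylAlgebra K)))
      ↔ ∀ b ∈ eigenvectorAlgebra K (y * x),
          ∃ n : ℕ, 1 ≤ n ∧ (fun c => x * c - c * x)^[n] b = 0)
    ∧ ((eigenvectorAlgebra K (y * x) = Algebra.adjoin K ({x, y} : Set (WeylAlgebra K)))
      ↔ ∀ b ∈ eigenvectorAlgebra K (y * x),
          ∃ n : ℕ, 1 ≤ n ∧ (fun c => y * c - c * y)^[n] b = 0)
    ∧ ((eigenvectorAlgebra K (y * x) = Algebra.adjoin K ({x, y} : Set (WeylAlgebra K)))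
      ↔ ∀ b ∈ eigenvectorAlgebra K (y * x),
          ∃ n : ℕ, 1 ≤ n ∧
            (fun c => x * (y * c - c * y) - (y * c - c * y) * x)^[n] b = 0) := by
  have hadj : Algebra.adjoin K ({x, y} : Set (WeylAlgebra K)) ≤ eigenvectorAlgebra K (y * x) := by
    refine Algebra.adjoin_le ?_
    rintro g (rfl | rfl)
    · refine Algebra.subset_adjoin ⟨1, ?_, WeylAux.adhx hxy⟩
      rintro rfl
      simp at hxy
    · refine Algebra.subset_adjoin ⟨-1, ?_, WeylAux.adhy hxy⟩
      rintro rfl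
      simp at hxy
  have ex : ∀ n b, (fun c => x * c - c * x)^[n] b = (WeylAux.ad x ^ n) b := by
    intro n b; rw [Module.End.pow_apply]; rfl
  have ey : ∀ n b, (fun c => y * c - c * y)^[n] b = (WeylAux.ad y ^ n) b := by
    intro n b; rw [Module.End.pow_apply]; rfl
  have exy : ∀ n b, (fun c => x * (y * c - c * y) - (y * c - c * y) * x)^[n] b =
      ((WeylAux.ad x * WeylAux.ad y) ^ n) b := by
    intro n b; rw [Module.End.pow_apply]; rfl
  simp only [ex, ey, exy]
  have hcomm : Commute (WeylAux.ad x) (WeylAux.ad y) := by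
    apply LinearMap.ext
    intro c
    exact WeylAux.ad_xy_comm hxy c
  have hab : eigenvectorAlgebra K (y * x) = Algebra.adjoin K ({x, y} : Set (WeylAlgebra K)) →
      ∀ b ∈ eigenvectorAlgebra K (y * x), ∃ n : ℕ, 1 ≤ n ∧ (WeylAux.ad x ^ n) b = 0 := by
    intro h b hb
    rw [h] at hb
    refine WeylAux.nil_adjoin' ?_ hb
    rintro g (rfl | rfl)
    · exact ⟨0, by simp [WeylAux.ad_apply]⟩
    · exact ⟨-1, WeylAux.adxy hxy⟩
  have hac : eigenvectorAlgebra K (y * x) = Algebra.adjoin K ({x, y} : Set (WeylAlgebra K)) →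
      ∀ b ∈ eigenvectorAlgebra K (y * x), ∃ n : ℕ, 1 ≤ n ∧ (WeylAux.ad y ^ n) b = 0 := by
    intro h b hb
    rw [h] at hb
    refine WeylAux.nil_adjoin' ?_ hb
    rintro g (rfl | rfl)
    · exact ⟨1, WeylAux.adyx hxy⟩
    · exact ⟨0, by simp [WeylAux.ad_apply]⟩
  have hbd : (∀ b ∈ eigenvectorAlgebra K (y * x), ∃ n : ℕ, 1 ≤ n ∧ (WeylAux.ad x ^ n) b = 0) →
      ∀ b ∈ eigenvectorAlgebra K (y * x),
        ∃ n : ℕ, 1 ≤ n ∧ ((WeylAux.ad x * WeylAux.ad y) ^ n) b = 0 := by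
    intro h b hb
    obtain ⟨n, hn, h0⟩ := h b hb
    refine ⟨n, hn, ?_⟩
    rw [hcomm.eq, hcomm.symm.mul_pow, Module.End.mul_apply, h0, map_zero]
  have hcd : (∀ b ∈ eigenvectorAlgebra K (y * x), ∃ n : ℕ, 1 ≤ n ∧ (WeylAux.ad y ^ n) b = 0) →
      ∀ b ∈ eigenvectorAlgebra K (y * x),
        ∃ n : ℕ, 1 ≤ n ∧ ((WeylAux.ad x * WeylAux.ad y) ^ n) b = 0 := by
    intro h b hb
    obtain ⟨n, hn, h0⟩ := h b hb
    refine ⟨n, hn, ?_⟩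
    rw [hcomm.mul_pow, Module.End.mul_apply, h0, map_zero]
  have hda : (∀ b ∈ eigenvectorAlgebra K (y * x),
        ∃ n : ℕ, 1 ≤ n ∧ ((WeylAux.ad x * WeylAux.ad y) ^ n) b = 0) →
      eigenvectorAlgebra K (y * x) = Algebra.adjoin K ({x, y} : Set (WeylAlgebra K)) := by
    intro h
    refine le_antisymm (Algebra.adjoin_le ?_) hadj
    rintro b ⟨l, hb0, hb⟩
    obtain ⟨n, _, hn⟩ := h b (Algebra.subset_adjoin ⟨l, hb0, hb⟩)
    exact WeylAux.W_le l (WeylAux.main_step hxy l n b hb hn)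
  exact ⟨⟨hab, fun h => hda (hbd h)⟩, ⟨hac, fun h => hda (hcd h)⟩, ⟨fun h => hbd (hab h), hda⟩⟩
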